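/- Define G^l(p) = sup_{y ∈ [0,R^l]} (−p y + min{H^l(y), A_max}) and G^r(p) = sup_{y ∈ [0,R^r]} (−p y + min{H^r(y), A_max}), and set, for t > 0, w(t,x) = −t G^l(x/t) for x ≤ 0 and w(t,x) = −t G^r(x/t) for x ≥ 0, and w(0,x) = φ̂_0(x). Then: (a) w is well defined (G^l(0) = G^r(0) = A_max, so w(t,0) = −t A_max) and continuous on [0,∞) × ℝ; (b) for t > 0, w(t,x) = 0 whenever x ≥ t (H^r)'(0) and w(t,x) = R^l x whenever x ≤ t (H^l)'(R^l); (c) w is a flux-limited viscosity solution with flux limiter A_max and initial datum φ̂_0. -/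

import Mathlib

open Set Filter MeasureTheory Topology

noncomputable section

/-- The class `Lip`: Lipschitz functions with `u' ∈ [0,Rl]` a.e. on `(-∞,0)` and
`u' ∈ [0,Rr]` a.e. on `(0,∞)`, expressed through difference quotients. -/
def LipClass (Rl Rr : ℝ) (u : ℝ → ℝ) : Prop :=
  (∀ x y : ℝ, x ≤ y → y ≤ 0 → 0 ≤ u y - u x ∧ u y - u x ≤ Rl * (y - x)) ∧
  (∀ x y : ℝ, 0 ≤ x → x ≤ y → 0 ≤ u y - u x ∧ u y - u x ≤ Rr * (y - x))

/-- The discontinuous Hamiltonian `H(x,p)`. -/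
def Hx (Hl Hr : ℝ → ℝ) (x p : ℝ) : ℝ := if x < 0 then Hl p else Hr p

/-- `A_max = min{max_{[0,Rl]} Hl, max_{[0,Rr]} Hr}`. -/
def Amax (Hl Hr : ℝ → ℝ) (Rl Rr : ℝ) : ℝ :=
  min (sSup (Hl '' Icc 0 Rl)) (sSup (Hr '' Icc 0 Rr))

/-- `(H^l)^+(p) = sup_{0 ≤ y ≤ p} H^l(y)`. -/
def Hplus (Hl : ℝ → ℝ) (p : ℝ) : ℝ := sSup (Hl '' Icc 0 p)

/-- `(H^r)^-(p) = sup_{p ≤ y ≤ Rr} H^r(y)`. -/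
def Hminus (Hr : ℝ → ℝ) (Rr p : ℝ) : ℝ := sSup (Hr '' Icc p Rr)

/-- `p_A^{·,-}`: the smallest solution in `[0,R]` of `Hf p = A`. -/
def pm (Hf : ℝ → ℝ) (R A : ℝ) : ℝ := sInf {p ∈ Icc 0 R | Hf p = A}

/-- `p_A^{·,+}`: the largest solution in `[0,R]` of `Hf p = A`. -/
def pp (Hf : ℝ → ℝ) (R A : ℝ) : ℝ := sSup {p ∈ Icc 0 R | Hf p = A}

/-- `φ̂_A`. -/
def phiHat (Hl Hr : ℝ → ℝ) (Rl Rr A x : ℝ) : ℝ :=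
  if x ≤ 0 then pp Hl Rl A * x else pm Hr Rr A * x

/-- `φ̌_A`. -/
def phiCheck (Hl Hr : ℝ → ℝ) (Rl Rr A x : ℝ) : ℝ :=
  if x ≤ 0 then pm Hl Rl A * x else pp Hr Rr A * x

/-- A junction test function, given by a pair (φl, φr) of C¹ functions agreeing at `x = 0`. -/
def JTF (φl φr : ℝ → ℝ → ℝ) : Prop :=
  ContDiff ℝ 1 (fun p : ℝ × ℝ => φl p.1 p.2) ∧
  ContDiff ℝ 1 (fun p : ℝ × ℝ => φr p.1 p.2) ∧
  ∀ t, φl t 0 = φr t 0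

/-- The glued junction test function. -/
def glue (φl φr : ℝ → ℝ → ℝ) (t x : ℝ) : ℝ := if x ≤ 0 then φl t x else φr t x

/-- The time-space domain `[0,∞) × ℝ`. -/
def domHJ : Set (ℝ × ℝ) := Ici (0 : ℝ) ×ˢ (univ : Set ℝ)

/-- Flux-limited viscosity solution with flux limiter `A` and initial datum `u0`. -/
def FLSol (Hl Hr : ℝ → ℝ) (Rl Rr A : ℝ) (u0 : ℝ → ℝ) (u : ℝ → ℝ → ℝ) : Prop :=
  ContinuousOn (fun p : ℝ × ℝ => u p.1 p.2) domHJ ∧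
  (∀ t : ℝ, 0 ≤ t → LipClass Rl Rr (u t)) ∧
  (∀ x, u 0 x = u0 x) ∧
  (∀ φl φr : ℝ → ℝ → ℝ, JTF φl φr →
    ∀ t x : ℝ, 0 < t →
      IsLocalMaxOn (fun p : ℝ × ℝ => u p.1 p.2 - glue φl φr p.1 p.2) domHJ (t, x) →
      (x < 0 → deriv (fun s => φl s x) t + Hl (deriv (φl t) x) ≤ 0) ∧
      (0 < x → deriv (fun s => φr s x) t + Hr (deriv (φr t) x) ≤ 0) ∧
      (x = 0 → deriv (fun s => φl s 0) t +
        min A (min (Hplus Hl (deriv (φl t) 0)) (Hminus Hr Rr (deriv (φr t) 0))) ≤ 0)) ∧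
  (∀ φl φr : ℝ → ℝ → ℝ, JTF φl φr →
    ∀ t x : ℝ, 0 < t →
      IsLocalMinOn (fun p : ℝ × ℝ => u p.1 p.2 - glue φl φr p.1 p.2) domHJ (t, x) →
      (x < 0 → 0 ≤ deriv (fun s => φl s x) t + Hl (deriv (φl t) x)) ∧
      (0 < x → 0 ≤ deriv (fun s => φr s x) t + Hr (deriv (φr t) x)) ∧
      (x = 0 → 0 ≤ deriv (fun s => φl s 0) t +
        min A (min (Hplus Hl (deriv (φl t) 0)) (Hminus Hr Rr (deriv (φr t) 0)))))

/-- Viscosity solution of `∂_t u + H(x, ∂_x u) = 0` on `(0,∞) × (ℝ \ {0})`. -/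
def ViscSolOff (Hl Hr : ℝ → ℝ) (u : ℝ → ℝ → ℝ) : Prop :=
  ∀ φ : ℝ → ℝ → ℝ, ContDiff ℝ 1 (fun p : ℝ × ℝ => φ p.1 p.2) →
    ∀ t x : ℝ, 0 < t → x ≠ 0 →
      (IsLocalMaxOn (fun p : ℝ × ℝ => u p.1 p.2 - φ p.1 p.2) domHJ (t, x) →
        deriv (fun s => φ s x) t + Hx Hl Hr x (deriv (φ t) x) ≤ 0) ∧
      (IsLocalMinOn (fun p : ℝ × ℝ => u p.1 p.2 - φ p.1 p.2) domHJ (t, x) →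
        0 ≤ deriv (fun s => φ s x) t + Hx Hl Hr x (deriv (φ t) x))

/-- `G^{l/r}(p) = sup_{y ∈ [0,R]} (−p y + min{H(y), A})`. -/
def GA (Hf : ℝ → ℝ) (R A p : ℝ) : ℝ := sSup ((fun y => -(p * y) + min (Hf y) A) '' Icc 0 R)

/-- The function `w`, equal to `φ̂_0` at `t = 0` and to `−t G^{l/r}(x/t)` for `t > 0`. -/
def wfun (Hl Hr : ℝ → ℝ) (Rl Rr : ℝ) (t x : ℝ) : ℝ :=
  if t ≤ 0 then phiHat Hl Hr Rl Rr 0 x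
  else if x ≤ 0 then -t * GA Hl Rl (Amax Hl Hr Rl Rr) (x / t)
  else -t * GA Hr Rr (Amax Hl Hr Rl Rr) (x / t)

/-- The value function `sup_{y ∈ [0,R]} (-x y + t min{H(y), A})`, the one-homogeneous version of
`GA`. -/
def scaledGA (H : ℝ → ℝ) (R A t x : ℝ) : ℝ :=
  sSup ((fun y => -(x * y) + t * min (H y) A) '' Icc 0 R)

section ScaledGA

variable {H : ℝ → ℝ} {R A : ℝ}

lemma le_scaledGA (hH : Continuous H) (t x : ℝ) {y : ℝ} (hy : y ∈ Icc 0 R) :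
    -(x * y) + t * min (H y) A ≤ scaledGA H R A t x :=
  le_csSup (isCompact_Icc.bddAbove_image (by fun_prop)) (mem_image_of_mem _ hy)

lemma exists_scaledGA_eq (hH : Continuous H) (hR : 0 ≤ R) (t x : ℝ) :
    ∃ y ∈ Icc 0 R, scaledGA H R A t x = -(x * y) + t * min (H y) A :=
  isCompact_Icc.exists_sSup_image_eq (nonempty_Icc.2 hR) (by fun_prop)

lemma continuous_scaledGA (hH : Continuous H) :
    Continuous fun p : ℝ × ℝ => scaledGA H R A p.1 p.2 := by
  have h := isCompact_Icc.continuous_sSup (K := Icc 0 R)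
    (f := fun (p : ℝ × ℝ) (y : ℝ) => -(p.2 * y) + p.1 * min (H y) A)
    (by simp only [Function.HasUncurry.uncurry, id]; fun_prop)
  exact h

lemma mul_GA_div (hH : Continuous H) (hR : 0 ≤ R) {t : ℝ} (ht : 0 < t) (x : ℝ) :
    t * GA H R A (x / t) = scaledGA H R A t x := by
  have hGA : GA H R A (x / t) = scaledGA H R A 1 (x / t) := by simp [GA, scaledGA]
  have hscale (y : ℝ) :
      t * (-(x / t * y) + 1 * min (H y) A) = -(x * y) + t * min (H y) A := by
    field_simp
  rw [hGA]
  apply le_antisymm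
  · obtain ⟨y, hy, e⟩ := exists_scaledGA_eq (A := A) hH hR 1 (x / t)
    rw [e, hscale]
    exact le_scaledGA hH t x hy
  · obtain ⟨y, hy, e⟩ := exists_scaledGA_eq (A := A) hH hR t x
    rw [e, ← hscale]
    exact mul_le_mul_of_nonneg_left (le_scaledGA hH 1 (x / t) hy) ht.le

lemma scaledGA_zero_right (hH : Continuous H) (hR : 0 ≤ R) (hA : ∃ p ∈ Icc 0 R, A ≤ H p)
    {t : ℝ} (ht : 0 ≤ t) : scaledGA H R A t 0 = t * A := by
  apply le_antisymm
  · obtain ⟨y, -, e⟩ := exists_scaledGA_eq (A := A) hH hR t 0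
    rw [e]
    have := mul_le_mul_of_nonneg_left (min_le_right (H y) A) ht
    linarith
  · obtain ⟨p, hp, hpA⟩ := hA
    have := le_scaledGA (A := A) hH t 0 hp
    rw [min_eq_right hpA] at this
    linarith

lemma scaledGA_zero_left_of_nonpos (hH : Continuous H) (hR : 0 ≤ R) {x : ℝ} (hx : x ≤ 0) :
    scaledGA H R A 0 x = -(R * x) := by
  apply le_antisymm
  · obtain ⟨y, hy, e⟩ := exists_scaledGA_eq (A := A) hH hR 0 x
    rw [e]
    nlinarith [hy.2]
  · have := le_scaledGA (A := A) hH 0 x (right_mem_Icc.2 hR)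
    linarith

lemma scaledGA_zero_left_of_nonneg (hH : Continuous H) (hR : 0 ≤ R) {x : ℝ} (hx : 0 ≤ x) :
    scaledGA H R A 0 x = 0 := by
  apply le_antisymm
  · obtain ⟨y, hy, e⟩ := exists_scaledGA_eq (A := A) hH hR 0 x
    rw [e]
    nlinarith [hy.1]
  · have := le_scaledGA (A := A) hH 0 x (left_mem_Icc.2 hR)
    linarith

lemma scaledGA_sub_mem (hH : Continuous H) (hR : 0 ≤ R) (t : ℝ) {x z : ℝ} (hxz : x ≤ z) :
    0 ≤ scaledGA H R A t x - scaledGA H R A t z ∧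
      scaledGA H R A t x - scaledGA H R A t z ≤ R * (z - x) := by
  constructor
  · obtain ⟨y, hy, e⟩ := exists_scaledGA_eq (A := A) hH hR t z
    have := le_scaledGA (A := A) hH t x hy
    rw [e]
    nlinarith [hy.1]
  · obtain ⟨y, hy, e⟩ := exists_scaledGA_eq (A := A) hH hR t x
    have := le_scaledGA (A := A) hH t z hy
    rw [e]
    nlinarith [hy.2]

lemma GA_zero (hH : Continuous H) (hR : 0 ≤ R) (hA : ∃ p ∈ Icc 0 R, A ≤ H p) :
    GA H R A 0 = A := by
  have h := mul_GA_div (A := A) hH hR one_pos 0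
  rw [scaledGA_zero_right hH hR hA zero_le_one] at h
  simpa using h

lemma scaledGA_eq_zero (hH : ContDiff ℝ 1 H) (hR : 0 ≤ R) (hc : ConcaveOn ℝ (Icc 0 R) H)
    (hH0 : H 0 = 0) (hA : 0 ≤ A) {t x : ℝ} (ht : 0 ≤ t) (hx : t * deriv H 0 ≤ x) :
    scaledGA H R A t x = 0 := by
  apply le_antisymm
  · obtain ⟨y, hy, e⟩ := exists_scaledGA_eq (A := A) hH.continuous hR t x
    have hHy : H y ≤ deriv H 0 * y := by
      rcases hy.1.eq_or_lt with rfl | hy0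
      · simp [hH0]
      · have := hc.slope_le_deriv (left_mem_Icc.2 hR) hy hy0
          (hH.differentiable one_ne_zero).differentiableAt
        rw [slope_def_field, hH0, sub_zero, sub_zero, div_le_iff₀ hy0] at this
        exact this
    have h1 := mul_le_mul_of_nonneg_left ((min_le_left (H y) A).trans hHy) ht
    have h2 := mul_le_mul_of_nonneg_right hx hy.1
    rw [e]
    linarith
  · have := le_scaledGA (A := A) hH.continuous t x (left_mem_Icc.2 hR)
    rw [hH0, min_eq_left hA] at this
    linarith

lemma scaledGA_eq_neg_mul (hH : ContDiff ℝ 1 H) (hR : 0 ≤ R) (hc : ConcaveOn ℝ (Icc 0 R) H)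
    (hHR : H R = 0) (hA : 0 ≤ A) {t x : ℝ} (ht : 0 ≤ t) (hx : x ≤ t * deriv H R) :
    scaledGA H R A t x = -(R * x) := by
  apply le_antisymm
  · obtain ⟨y, hy, e⟩ := exists_scaledGA_eq (A := A) hH.continuous hR t x
    have hHy : H y ≤ deriv H R * (y - R) := by
      rcases hy.2.eq_or_lt with rfl | hyR
      · simp [hHR]
      · have := hc.deriv_le_slope hy (right_mem_Icc.2 hR) hyR
          (hH.differentiable one_ne_zero).differentiableAt
        rw [slope_def_field, hHR, le_div_iff₀ (sub_pos.2 hyR)] at this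
        linarith
    have h1 := mul_le_mul_of_nonneg_left ((min_le_left (H y) A).trans hHy) ht
    have h2 := mul_le_mul_of_nonneg_right hx (sub_nonneg.2 hy.2)
    rw [e]
    linarith
  · have := le_scaledGA (A := A) hH.continuous t x (right_mem_Icc.2 hR)
    rw [hHR, min_eq_left hA] at this
    linarith

/-- A maximizer in the definition of `scaledGA` never lies strictly above the truncation level. -/
lemma le_of_scaledGA_eq (hH : Continuous H) (hH0 : H 0 = 0) (hHR : H R = 0) (hA : 0 ≤ A)
    {t x y : ℝ} (hx : x ≠ 0) (hy : y ∈ Icc 0 R)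
    (e : scaledGA H R A t x = -(x * y) + t * min (H y) A) : H y ≤ A := by
  by_contra! hlt
  have hy0 : 0 < y := hy.1.lt_of_ne (by rintro rfl; linarith)
  have hyR : y < R := hy.2.lt_of_ne (by rintro rfl; linarith)
  have hmax : IsLocalMax (fun z => -(x * z) + t * A) y := by
    filter_upwards [Icc_mem_nhds hy0 hyR, hH.continuousAt.eventually_const_lt hlt] with z hz hzA
    have := le_scaledGA (A := A) hH t x hz
    rwa [e, min_eq_right hlt.le, min_eq_right hzA.le] at this
  have hd : HasDerivAt (fun z => -(x * z) + t * A) (-(x * 1)) y :=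
    (((hasDerivAt_id y).const_mul x).neg).add_const _
  have := hmax.hasDerivAt_eq_zero hd
  exact hx (by linarith)

lemma eq_of_scaledGA_eq (hH : Continuous H) (hc : StrictConcaveOn ℝ (Icc 0 R) H)
    (hH0 : H 0 = 0) (hHR : H R = 0) (hA : 0 ≤ A) {t x y z : ℝ} (ht : 0 < t) (hx : x ≠ 0)
    (hy : y ∈ Icc 0 R) (ey : scaledGA H R A t x = -(x * y) + t * min (H y) A)
    (hz : z ∈ Icc 0 R) (ez : scaledGA H R A t x = -(x * z) + t * min (H z) A) : y = z := by
  by_contra hne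
  have hyA := le_of_scaledGA_eq hH hH0 hHR hA hx hy ey
  have hzA := le_of_scaledGA_eq hH hH0 hHR hA hx hz ez
  have hhalf : (0 : ℝ) < 1 / 2 := by norm_num
  have hmid := hc.2 hy hz hne hhalf hhalf (by norm_num)
  have hmem := hc.1 hy hz hhalf.le hhalf.le (by norm_num)
  simp only [smul_eq_mul] at hmid hmem
  have hle := le_scaledGA (A := A) hH t x hmem
  rw [min_eq_left hyA] at ey
  rw [min_eq_left hzA] at ez
  rcases le_total (H (1 / 2 * y + 1 / 2 * z)) A with h | h
  · rw [min_eq_left h] at hle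
    have := mul_lt_mul_of_pos_left hmid ht
    linarith
  · rw [min_eq_right h] at hle
    have h1 : t * A ≤ t * (1 / 2 * H y + 1 / 2 * H z) := by linarith
    have h2 := le_of_mul_le_mul_left h1 ht
    have hyA' : H y = A := by linarith
    have hzA' : H z = A := by linarith
    rw [hyA'] at ey
    rw [hzA'] at ez
    exact hne (mul_left_cancel₀ hx (by linarith))

/-- One-sided envelope estimate along a line for functions touching `-scaledGA` from above. -/
lemma exists_maximizer_le_deriv (hH : Continuous H) (hR : 0 ≤ R) {t x a b d : ℝ} {ψ : ℝ → ℝ}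
    (hmax : IsLocalMax (fun h => -scaledGA H R A (t + a * h) (x + b * h) - ψ h) 0)
    (hψ : HasDerivAt ψ d 0) :
    ∃ y ∈ Icc 0 R, scaledGA H R A t x = -(x * y) + t * min (H y) A ∧
      b * y - a * min (H y) A ≤ d := by
  choose Y hY eY using fun h : ℝ =>
    exists_scaledGA_eq (A := A) hH hR (t + a * h) (x + b * h)
  obtain ⟨h, -, hpos, hlim⟩ := exists_seq_strictAnti_tendsto (0 : ℝ)
  obtain ⟨y, hy, σ, hσ, hYlim⟩ := isCompact_Icc.tendsto_subseq fun n => hY (h n)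
  have hhσ : Tendsto (fun n => h (σ n)) atTop (𝓝 0) := hlim.comp hσ.tendsto_atTop
  have hhσ' : Tendsto (fun n => h (σ n)) atTop (𝓝[>] 0) :=
    tendsto_nhdsWithin_iff.2 ⟨hhσ, .of_forall fun n => hpos (σ n)⟩
  have hmlim : Tendsto (fun n => min (H (Y (h (σ n)))) A) atTop (𝓝 (min (H y) A)) :=
    ((hH.min continuous_const).tendsto y).comp hYlim
  have htlim : Tendsto (fun n => t + a * h (σ n)) atTop (𝓝 t) := by
    simpa using (hhσ.const_mul a).const_add t
  have hxlim : Tendsto (fun n => x + b * h (σ n)) atTop (𝓝 x) := by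
    simpa using (hhσ.const_mul b).const_add x
  refine ⟨y, hy, ?_, ?_⟩
  · have hleft : Tendsto (fun n => scaledGA H R A (t + a * h (σ n)) (x + b * h (σ n))) atTop
        (𝓝 (scaledGA H R A t x)) := by
      have hcont := (continuous_scaledGA (R := R) (A := A) hH).tendsto (t, x)
      simpa only [Function.comp_def] using hcont.comp (htlim.prodMk_nhds hxlim)
    refine tendsto_nhds_unique (hleft.congr fun n => eY (h (σ n))) ?_
    exact (hxlim.mul hYlim).neg.add (htlim.mul hmlim)
  · refine le_of_tendsto_of_tendsto ((hYlim.const_mul b).sub (hmlim.const_mul a))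
      (hψ.tendsto_slope_zero_right.comp hhσ') ?_
    filter_upwards [hhσ.eventually hmax] with n hn
    have hle := le_scaledGA (A := A) hH t x (hY (h (σ n)))
    have hp := hpos (σ n)
    rw [eY] at hn
    simp only [mul_zero, add_zero] at hn
    simp only [Function.comp, zero_add, smul_eq_mul]
    rw [le_inv_mul_iff₀ hp]
    linarith

lemma hasDerivAt_eq_of_isLocalMax (hH : Continuous H) (hR : 0 ≤ R)
    (hc : StrictConcaveOn ℝ (Icc 0 R) H) (hH0 : H 0 = 0) (hHR : H R = 0) (hA : 0 ≤ A)
    {t x y a b d : ℝ} {ψ : ℝ → ℝ} (ht : 0 < t) (hx : x ≠ 0) (hy : y ∈ Icc 0 R)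
    (ey : scaledGA H R A t x = -(x * y) + t * min (H y) A)
    (hmax : IsLocalMax (fun h => -scaledGA H R A (t + a * h) (x + b * h) - ψ h) 0)
    (hψ : HasDerivAt ψ d 0) : d = b * y - a * min (H y) A := by
  apply le_antisymm
  · have hmax' : IsLocalMax
        (fun h => -scaledGA H R A (t + -a * h) (x + -b * h) - ψ (-h)) 0 := by
      have hneg : Tendsto (fun h : ℝ => -h) (𝓝 0) (𝓝 0) := by
        simpa using (continuous_neg (G := ℝ)).tendsto 0
      filter_upwards [hneg.eventually hmax] with h hh
      simpa using hh
    have hψ' : HasDerivAt (fun h => ψ (-h)) (-d) 0 := by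
      have h0 : HasDerivAt ψ d (-0) := by simpa using hψ
      simpa [Function.comp_def] using h0.comp (0 : ℝ) (hasDerivAt_neg (0 : ℝ))
    obtain ⟨z, hz, ez, hle⟩ := exists_maximizer_le_deriv hH hR hmax' hψ'
    rw [← eq_of_scaledGA_eq hH hc hH0 hHR hA ht hx hy ey hz ez] at hle
    linarith
  · obtain ⟨z, hz, ez, hle⟩ := exists_maximizer_le_deriv hH hR hmax hψ
    rwa [← eq_of_scaledGA_eq hH hc hH0 hHR hA ht hx hy ey hz ez] at hle

lemma subsolution_scaledGA (hH : Continuous H) (hR : 0 ≤ R)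
    (hc : StrictConcaveOn ℝ (Icc 0 R) H) (hH0 : H 0 = 0) (hHR : H R = 0) (hA : 0 ≤ A)
    {φ : ℝ → ℝ → ℝ} (hφ : ContDiff ℝ 1 fun p : ℝ × ℝ => φ p.1 p.2) {t x : ℝ} (ht : 0 < t)
    (hx : x ≠ 0)
    (hmax : IsLocalMax (fun p : ℝ × ℝ => -scaledGA H R A p.1 p.2 - φ p.1 p.2) (t, x)) :
    deriv (fun s => φ s x) t + H (deriv (φ t) x) ≤ 0 := by
  obtain ⟨y, hy, ey⟩ := exists_scaledGA_eq (A := A) hH hR t x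
  have hd := hφ.differentiable one_ne_zero
  have hdt : DifferentiableAt ℝ (fun s => φ s x) t :=
    (hd.comp (g := fun p : ℝ × ℝ => φ p.1 p.2) (f := fun s : ℝ => (s, x)) (by fun_prop)) t
  have hdx : DifferentiableAt ℝ (φ t) x :=
    (hd.comp (g := fun p : ℝ × ℝ => φ p.1 p.2) (f := fun z : ℝ => (t, z)) (by fun_prop)) x
  have hline (a b : ℝ) : IsLocalMax (fun h =>
      -scaledGA H R A (t + a * h) (x + b * h) - φ (t + a * h) (x + b * h)) 0 := by
    have hlim : Tendsto (fun h : ℝ => (t + a * h, x + b * h)) (𝓝 0) (𝓝 (t, x)) := by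
      have : Continuous fun h : ℝ => (t + a * h, x + b * h) := by fun_prop
      simpa using this.tendsto 0
    filter_upwards [hlim.eventually hmax] with h hh
    simpa using hh
  have h1 : deriv (fun s => φ s x) t = 0 * y - 1 * min (H y) A := by
    refine hasDerivAt_eq_of_isLocalMax hH hR hc hH0 hHR hA ht hx hy ey (hline 1 0) ?_
    have h0 : HasDerivAt (fun s => φ s x) (deriv (fun s => φ s x) t) (t + 0) := by
      simpa using hdt.hasDerivAt
    simpa using h0.comp_const_add t 0
  have h2 : deriv (φ t) x = 1 * y - 0 * min (H y) A := by
    refine hasDerivAt_eq_of_isLocalMax hH hR hc hH0 hHR hA ht hx hy ey (hline 0 1) ?_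
    have h0 : HasDerivAt (φ t) (deriv (φ t) x) (x + 0) := by simpa using hdx.hasDerivAt
    simpa using h0.comp_const_add x 0
  have hyA := le_of_scaledGA_eq hH hH0 hHR hA hx hy ey
  rw [min_eq_left hyA] at h1
  rw [h1, h2]
  simp

lemma supersolution_scaledGA (hH : Continuous H) (hR : 0 ≤ R)
    {φ : ℝ → ℝ → ℝ} (hφ : ContDiff ℝ 1 fun p : ℝ × ℝ => φ p.1 p.2) {t x : ℝ}
    (hmin : IsLocalMin (fun p : ℝ × ℝ => -scaledGA H R A p.1 p.2 - φ p.1 p.2) (t, x)) :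
    0 ≤ deriv (fun s => φ s x) t + H (deriv (φ t) x) := by
  obtain ⟨y, hy, ey⟩ := exists_scaledGA_eq (A := A) hH hR t x
  have hd := hφ.differentiable one_ne_zero
  have hdt : DifferentiableAt ℝ (fun s => φ s x) t :=
    (hd.comp (g := fun p : ℝ × ℝ => φ p.1 p.2) (f := fun s : ℝ => (s, x)) (by fun_prop)) t
  have hdx : DifferentiableAt ℝ (φ t) x :=
    (hd.comp (g := fun p : ℝ × ℝ => φ p.1 p.2) (f := fun z : ℝ => (t, z)) (by fun_prop)) x
  have hmin' : ∀ᶠ p : ℝ × ℝ in 𝓝 (t, x),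
      x * y - t * min (H y) A - φ t x ≤ p.2 * y - p.1 * min (H y) A - φ p.1 p.2 := by
    filter_upwards [hmin] with p hp
    have := le_scaledGA (A := A) hH p.1 p.2 hy
    simp only [ey] at hp
    linarith
  have h1 : IsLocalMin (fun s => x * y - s * min (H y) A - φ s x) t :=
    ((by fun_prop : Continuous fun s : ℝ => (s, x)).tendsto t).eventually hmin'
  have h2 : IsLocalMin (fun z => z * y - t * min (H y) A - φ t z) x :=
    ((by fun_prop : Continuous fun z : ℝ => (t, z)).tendsto x).eventually hmin'
  have e1 := h1.hasDerivAt_eq_zero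
    ((((hasDerivAt_id t).mul_const (min (H y) A)).const_sub (x * y)).sub hdt.hasDerivAt)
  have e2 := h2.hasDerivAt_eq_zero
    ((((hasDerivAt_id x).mul_const y).sub_const (t * min (H y) A)).sub hdx.hasDerivAt)
  have e3 : deriv (φ t) x = y := by linarith
  rw [e3]
  linarith [min_le_left (H y) A]

end ScaledGA

lemma pp_zero {H : ℝ → ℝ} {R : ℝ} (hR : 0 ≤ R) (hHR : H R = 0) : pp H R 0 = R :=
  (show IsGreatest {p ∈ Icc 0 R | H p = 0} R from
    ⟨⟨right_mem_Icc.2 hR, hHR⟩, fun _ hp => hp.1.2⟩).csSup_eq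

lemma pm_zero {H : ℝ → ℝ} {R : ℝ} (hR : 0 ≤ R) (hH0 : H 0 = 0) : pm H R 0 = 0 :=
  (show IsLeast {p ∈ Icc 0 R | H p = 0} 0 from
    ⟨⟨left_mem_Icc.2 hR, hH0⟩, fun _ hp => hp.1.1⟩).csInf_eq

lemma le_Hplus {H : ℝ → ℝ} (hH : Continuous H) {p q : ℝ} (hp : 0 ≤ p) (hpq : p ≤ q) :
    H p ≤ Hplus H q :=
  le_csSup (isCompact_Icc.bddAbove_image hH.continuousOn) (mem_image_of_mem _ ⟨hp, hpq⟩)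

lemma le_Hminus {H : ℝ → ℝ} (hH : Continuous H) {R p q : ℝ} (hp : p ≤ R) (hqp : q ≤ p) :
    H p ≤ Hminus H R q :=
  le_csSup (isCompact_Icc.bddAbove_image hH.continuousOn) (mem_image_of_mem _ ⟨hqp, hp⟩)

section Wfun

variable {Hl Hr : ℝ → ℝ} {Rl Rr : ℝ}

lemma exists_Amax_le_left (hRl : 0 ≤ Rl) (hHl : Continuous Hl) :
    ∃ p ∈ Icc 0 Rl, Amax Hl Hr Rl Rr ≤ Hl p := by
  obtain ⟨p, hp, e⟩ := isCompact_Icc.exists_sSup_image_eq (nonempty_Icc.2 hRl) hHl.continuousOn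
  exact ⟨p, hp, e ▸ min_le_left _ _⟩

lemma exists_Amax_le_right (hRr : 0 ≤ Rr) (hHr : Continuous Hr) :
    ∃ p ∈ Icc 0 Rr, Amax Hl Hr Rl Rr ≤ Hr p := by
  obtain ⟨p, hp, e⟩ := isCompact_Icc.exists_sSup_image_eq (nonempty_Icc.2 hRr) hHr.continuousOn
  exact ⟨p, hp, e ▸ min_le_right _ _⟩

lemma Amax_nonneg (hRl : 0 ≤ Rl) (hRr : 0 ≤ Rr) (hHl : Continuous Hl) (hHr : Continuous Hr)
    (hHl0 : Hl 0 = 0) (hHr0 : Hr 0 = 0) : 0 ≤ Amax Hl Hr Rl Rr := by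
  refine le_min ?_ ?_
  · exact le_csSup (isCompact_Icc.bddAbove_image hHl.continuousOn)
      ⟨0, left_mem_Icc.2 hRl, hHl0⟩
  · exact le_csSup (isCompact_Icc.bddAbove_image hHr.continuousOn)
      ⟨0, left_mem_Icc.2 hRr, hHr0⟩

lemma wfun_of_nonpos (hRl : 0 ≤ Rl) (hHl : Continuous Hl) (hHlR : Hl Rl = 0)
    {t x : ℝ} (ht : 0 ≤ t) (hx : x ≤ 0) :
    wfun Hl Hr Rl Rr t x = -scaledGA Hl Rl (Amax Hl Hr Rl Rr) t x := by
  rcases ht.eq_or_lt with rfl | ht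
  · simp [wfun, phiHat, hx, pp_zero hRl hHlR, scaledGA_zero_left_of_nonpos hHl hRl hx]
  · simp [wfun, ht.not_ge, hx, mul_GA_div hHl hRl ht]

lemma wfun_of_pos (hRr : 0 ≤ Rr) (hHr : Continuous Hr) (hHr0 : Hr 0 = 0)
    {t x : ℝ} (ht : 0 ≤ t) (hx : 0 < x) :
    wfun Hl Hr Rl Rr t x = -scaledGA Hr Rr (Amax Hl Hr Rl Rr) t x := by
  rcases ht.eq_or_lt with rfl | ht
  · simp [wfun, phiHat, hx.not_ge, pm_zero hRr hHr0, scaledGA_zero_left_of_nonneg hHr hRr hx.le]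
  · simp [wfun, ht.not_ge, hx.not_ge, mul_GA_div hHr hRr ht]

lemma wfun_zero_right (hRl : 0 ≤ Rl) (hHl : Continuous Hl) (hHlR : Hl Rl = 0)
    {t : ℝ} (ht : 0 ≤ t) : wfun Hl Hr Rl Rr t 0 = -t * Amax Hl Hr Rl Rr := by
  rw [wfun_of_nonpos hRl hHl hHlR ht le_rfl,
    scaledGA_zero_right hHl hRl (exists_Amax_le_left hRl hHl) ht, neg_mul]

lemma wfun_of_nonneg (hRl : 0 ≤ Rl) (hHl : Continuous Hl) (hHlR : Hl Rl = 0)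
    (hRr : 0 ≤ Rr) (hHr : Continuous Hr) (hHr0 : Hr 0 = 0)
    {t x : ℝ} (ht : 0 ≤ t) (hx : 0 ≤ x) :
    wfun Hl Hr Rl Rr t x = -scaledGA Hr Rr (Amax Hl Hr Rl Rr) t x := by
  rcases hx.eq_or_lt with rfl | hx
  · rw [wfun_zero_right hRl hHl hHlR ht,
      scaledGA_zero_right hHr hRr (exists_Amax_le_right hRr hHr) ht, neg_mul]
  · exact wfun_of_pos hRr hHr hHr0 ht hx

lemma continuousOn_wfun (hRl : 0 ≤ Rl) (hHl : Continuous Hl) (hHlR : Hl Rl = 0)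
    (hRr : 0 ≤ Rr) (hHr : Continuous Hr) (hHr0 : Hr 0 = 0) :
    ContinuousOn (fun p : ℝ × ℝ => wfun Hl Hr Rl Rr p.1 p.2) domHJ := by
  set A := Amax Hl Hr Rl Rr
  have hproj : Continuous fun p : ℝ × ℝ => (max p.1 0, p.2) := by fun_prop
  have hcont : Continuous fun p : ℝ × ℝ => if p.2 ≤ 0 then
      -scaledGA Hl Rl A (max p.1 0) p.2 else -scaledGA Hr Rr A (max p.1 0) p.2 := by
    refine Continuous.if_le ((continuous_scaledGA hHl).comp hproj).neg
      ((continuous_scaledGA hHr).comp hproj).neg continuous_snd continuous_const ?_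
    intro p hp
    rw [hp, scaledGA_zero_right hHl hRl (exists_Amax_le_left hRl hHl) (le_max_right _ _),
      scaledGA_zero_right hHr hRr (exists_Amax_le_right hRr hHr) (le_max_right _ _)]
  refine hcont.continuousOn.congr fun p hp => ?_
  have ht : 0 ≤ p.1 := hp.1
  simp only [max_eq_left ht]
  split_ifs with h
  · exact wfun_of_nonpos hRl hHl hHlR ht h
  · exact wfun_of_pos hRr hHr hHr0 ht (not_le.1 h)

lemma domHJ_mem_nhds {t : ℝ} (ht : 0 < t) (x : ℝ) : domHJ ∈ 𝓝 (t, x) :=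
  prod_mem_nhds (Ici_mem_nhds ht) univ_mem

lemma wfun_sub_glue_eventuallyEq_left (hRl : 0 ≤ Rl) (hHl : Continuous Hl) (hHlR : Hl Rl = 0)
    (φl φr : ℝ → ℝ → ℝ) {t x : ℝ} (ht : 0 < t) (hx : x < 0) :
    (fun p : ℝ × ℝ => wfun Hl Hr Rl Rr p.1 p.2 - glue φl φr p.1 p.2) =ᶠ[𝓝 (t, x)]
      fun p => -scaledGA Hl Rl (Amax Hl Hr Rl Rr) p.1 p.2 - φl p.1 p.2 := by
  filter_upwards [prod_mem_nhds (Ici_mem_nhds ht) (Iic_mem_nhds hx)] with p hp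
  have hp2 : p.2 ≤ 0 := hp.2
  rw [wfun_of_nonpos hRl hHl hHlR hp.1 hp2, glue, if_pos hp2]

lemma wfun_sub_glue_eventuallyEq_right (hRr : 0 ≤ Rr) (hHr : Continuous Hr) (hHr0 : Hr 0 = 0)
    (φl φr : ℝ → ℝ → ℝ) {t x : ℝ} (ht : 0 < t) (hx : 0 < x) :
    (fun p : ℝ × ℝ => wfun Hl Hr Rl Rr p.1 p.2 - glue φl φr p.1 p.2) =ᶠ[𝓝 (t, x)]
      fun p => -scaledGA Hr Rr (Amax Hl Hr Rl Rr) p.1 p.2 - φr p.1 p.2 := by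
  filter_upwards [prod_mem_nhds (Ici_mem_nhds ht) (Ioi_mem_nhds hx)] with p hp
  have hp2 : 0 < p.2 := hp.2
  rw [wfun_of_pos hRr hHr hHr0 hp.1 hp2, glue, if_neg hp2.not_ge]

/-- On the junction, `wfun` is linear in time, which determines the time derivative of any test
function touching it there. -/
lemma deriv_time_eq_of_isLocalExtr (hRl : 0 ≤ Rl) (hHl : Continuous Hl) (hHlR : Hl Rl = 0)
    {φl φr : ℝ → ℝ → ℝ} (hφl : ContDiff ℝ 1 fun p : ℝ × ℝ => φl p.1 p.2) {t : ℝ} (ht : 0 < t)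
    (hext : IsLocalExtr (fun p : ℝ × ℝ => wfun Hl Hr Rl Rr p.1 p.2 - glue φl φr p.1 p.2) (t, 0)) :
    deriv (fun s => φl s 0) t = -Amax Hl Hr Rl Rr := by
  have hd : DifferentiableAt ℝ (fun s => φl s 0) t :=
    ((hφl.differentiable one_ne_zero).comp (g := fun p : ℝ × ℝ => φl p.1 p.2)
      (f := fun s : ℝ => (s, 0)) (by fun_prop)) t
  have hline : IsLocalExtr (fun s => wfun Hl Hr Rl Rr s 0 - glue φl φr s 0) t :=
    hext.comp_continuous (g := fun s : ℝ => (s, 0)) (b := t) (by fun_prop)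
  have heq : (fun s => wfun Hl Hr Rl Rr s 0 - glue φl φr s 0) =ᶠ[𝓝 t]
      fun s => -s * Amax Hl Hr Rl Rr - φl s 0 := by
    filter_upwards [Ici_mem_nhds ht] with s hs
    rw [wfun_zero_right hRl hHl hHlR hs, glue, if_pos le_rfl]
  have hder := (((hasDerivAt_id t).neg.mul_const (Amax Hl Hr Rl Rr)).sub hd.hasDerivAt)
  have := (hline.congr heq).hasDerivAt_eq_zero hder
  linarith

lemma le_deriv_of_isLocalMin_junction (hRl : 0 ≤ Rl) (hHl : Continuous Hl) (hHlR : Hl Rl = 0)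
    {φl φr : ℝ → ℝ → ℝ} (hφl : ContDiff ℝ 1 fun p : ℝ × ℝ => φl p.1 p.2) {t p : ℝ} (ht : 0 < t)
    (hp : p ∈ Icc 0 Rl) (hpA : Amax Hl Hr Rl Rr ≤ Hl p)
    (hmin : IsLocalMin (fun p : ℝ × ℝ => wfun Hl Hr Rl Rr p.1 p.2 - glue φl φr p.1 p.2) (t, 0)) :
    p ≤ deriv (φl t) 0 := by
  have hd : DifferentiableAt ℝ (φl t) 0 :=
    ((hφl.differentiable one_ne_zero).comp (g := fun p : ℝ × ℝ => φl p.1 p.2)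
      (f := fun z : ℝ => (t, z)) (by fun_prop)) 0
  refine ge_of_tendsto hd.hasDerivAt.tendsto_slope_zero_left ?_
  have hline : ∀ᶠ z in 𝓝 (0 : ℝ), wfun Hl Hr Rl Rr t 0 - glue φl φr t 0 ≤
      wfun Hl Hr Rl Rr t z - glue φl φr t z :=
    ((by fun_prop : Continuous fun z : ℝ => (t, z)).tendsto 0).eventually hmin
  filter_upwards [nhdsWithin_le_nhds hline, self_mem_nhdsWithin] with z hz hz0
  have hz0 : z < 0 := hz0
  have hle := le_scaledGA (A := Amax Hl Hr Rl Rr) hHl t z hp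
  rw [min_eq_right hpA] at hle
  rw [wfun_zero_right hRl hHl hHlR ht.le, wfun_of_nonpos hRl hHl hHlR ht.le hz0.le, glue, glue,
    if_pos le_rfl, if_pos hz0.le] at hz
  rw [zero_add, smul_eq_mul, inv_mul_eq_div, le_div_iff_of_neg hz0]
  linarith

lemma deriv_le_of_isLocalMin_junction (hRl : 0 ≤ Rl) (hHl : Continuous Hl) (hHlR : Hl Rl = 0)
    (hRr : 0 ≤ Rr) (hHr : Continuous Hr) (hHr0 : Hr 0 = 0)
    {φl φr : ℝ → ℝ → ℝ} (hφr : ContDiff ℝ 1 fun p : ℝ × ℝ => φr p.1 p.2) {t p : ℝ} (ht : 0 < t)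
    (hφ : φl t 0 = φr t 0) (hp : p ∈ Icc 0 Rr) (hpA : Amax Hl Hr Rl Rr ≤ Hr p)
    (hmin : IsLocalMin (fun p : ℝ × ℝ => wfun Hl Hr Rl Rr p.1 p.2 - glue φl φr p.1 p.2) (t, 0)) :
    deriv (φr t) 0 ≤ p := by
  have hd : DifferentiableAt ℝ (φr t) 0 :=
    ((hφr.differentiable one_ne_zero).comp (g := fun p : ℝ × ℝ => φr p.1 p.2)
      (f := fun z : ℝ => (t, z)) (by fun_prop)) 0
  refine le_of_tendsto hd.hasDerivAt.tendsto_slope_zero_right ?_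
  have hline : ∀ᶠ z in 𝓝 (0 : ℝ), wfun Hl Hr Rl Rr t 0 - glue φl φr t 0 ≤
      wfun Hl Hr Rl Rr t z - glue φl φr t z :=
    ((by fun_prop : Continuous fun z : ℝ => (t, z)).tendsto 0).eventually hmin
  filter_upwards [nhdsWithin_le_nhds hline, self_mem_nhdsWithin] with z hz hz0
  have hz0 : 0 < z := hz0
  have hle := le_scaledGA (A := Amax Hl Hr Rl Rr) hHr t z hp
  rw [min_eq_right hpA] at hle
  rw [wfun_zero_right hRl hHl hHlR ht.le, wfun_of_pos hRr hHr hHr0 ht.le hz0, glue, glue,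
    if_pos le_rfl, if_neg hz0.not_ge, hφ] at hz
  rw [zero_add, smul_eq_mul, inv_mul_eq_div, div_le_iff₀ hz0]
  linarith

end Wfun

/-- properties of `w`: it is well defined and continuous, has the stated
values for `x ≥ t (H^r)'(0)` and `x ≤ t (H^l)'(R^l)`, and is the flux-limited viscosity
solution with flux limiter `A_max` and initial datum `φ̂_0`. -/
theorem w_properties
    (Hl Hr : ℝ → ℝ) (Rl Rr : ℝ) (hRl : 0 < Rl) (hRr : 0 < Rr)
    (hHl : ContDiff ℝ 1 Hl) (hHlc : StrictConcaveOn ℝ (Icc 0 Rl) Hl)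
    (hHl0 : Hl 0 = 0) (hHlR : Hl Rl = 0)
    (hHr : ContDiff ℝ 1 Hr) (hHrc : StrictConcaveOn ℝ (Icc 0 Rr) Hr)
    (hHr0 : Hr 0 = 0) (hHrR : Hr Rr = 0) :
    -- (a)
    (GA Hl Rl (Amax Hl Hr Rl Rr) 0 = Amax Hl Hr Rl Rr ∧
     GA Hr Rr (Amax Hl Hr Rl Rr) 0 = Amax Hl Hr Rl Rr ∧
     (∀ t : ℝ, 0 ≤ t → wfun Hl Hr Rl Rr t 0 = -t * Amax Hl Hr Rl Rr) ∧
     ContinuousOn (fun p : ℝ × ℝ => wfun Hl Hr Rl Rr p.1 p.2) domHJ) ∧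
    -- (b)
    (∀ t : ℝ, 0 < t →
      (∀ x : ℝ, t * deriv Hr 0 ≤ x → wfun Hl Hr Rl Rr t x = 0) ∧
      (∀ x : ℝ, x ≤ t * deriv Hl Rl → wfun Hl Hr Rl Rr t x = Rl * x)) ∧
    -- (c)
    FLSol Hl Hr Rl Rr (Amax Hl Hr Rl Rr) (phiHat Hl Hr Rl Rr 0) (wfun Hl Hr Rl Rr) := by
  have cl := hHl.continuous
  have cr := hHr.continuous
  have hA : 0 ≤ Amax Hl Hr Rl Rr := Amax_nonneg hRl.le hRr.le cl cr hHl0 hHr0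
  have hcont := continuousOn_wfun hRl.le cl hHlR hRr.le cr hHr0
  obtain ⟨pl, hpl, hplA⟩ := exists_Amax_le_left (Hr := Hr) (Rr := Rr) hRl.le cl
  obtain ⟨pr, hpr, hprA⟩ := exists_Amax_le_right (Hl := Hl) (Rl := Rl) hRr.le cr
  refine ⟨⟨GA_zero cl hRl.le ⟨pl, hpl, hplA⟩, GA_zero cr hRr.le ⟨pr, hpr, hprA⟩,
    fun t ht => wfun_zero_right hRl.le cl hHlR ht, hcont⟩,
    fun t ht => ⟨fun x hx => ?_, fun x hx => ?_⟩, hcont, fun t ht => ⟨?_, ?_⟩, fun x => ?_, ?_, ?_⟩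
  · have hd : 0 < deriv Hr 0 := by
      simpa [slope_def_field, hHr0, hHrR] using hHrc.slope_lt_deriv (left_mem_Icc.2 hRr.le)
        (right_mem_Icc.2 hRr.le) hRr (hHr.differentiable one_ne_zero).differentiableAt
    rw [wfun_of_pos hRr.le cr hHr0 ht.le ((mul_pos ht hd).trans_le hx),
      scaledGA_eq_zero hHr hRr.le hHrc.concaveOn hHr0 hA ht.le hx, neg_zero]
  · have hd : deriv Hl Rl < 0 := by
      simpa [slope_def_field, hHl0, hHlR] using hHlc.deriv_lt_slope (left_mem_Icc.2 hRl.le)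
        (right_mem_Icc.2 hRl.le) hRl (hHl.differentiable one_ne_zero).differentiableAt
    rw [wfun_of_nonpos hRl.le cl hHlR ht.le (hx.trans (mul_neg_of_pos_of_neg ht hd).le),
      scaledGA_eq_neg_mul hHl hRl.le hHlc.concaveOn hHlR hA ht.le hx, neg_neg]
  · intro x y hxy hy
    rw [wfun_of_nonpos hRl.le cl hHlR ht hy, wfun_of_nonpos hRl.le cl hHlR ht (hxy.trans hy),
      neg_sub_neg]
    exact scaledGA_sub_mem cl hRl.le t hxy
  · intro x y hx hxy
    rw [wfun_of_nonneg hRl.le cl hHlR hRr.le cr hHr0 ht hx,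
      wfun_of_nonneg hRl.le cl hHlR hRr.le cr hHr0 ht (hx.trans hxy), neg_sub_neg]
    exact scaledGA_sub_mem cr hRr.le t hxy
  · simp [wfun]
  · rintro φl φr ⟨hφl, hφr, -⟩ t x ht hmaxOn
    have hmax := hmaxOn.isLocalMax (domHJ_mem_nhds ht x)
    refine ⟨fun hx => ?_, fun hx => ?_, ?_⟩
    · exact subsolution_scaledGA cl hRl.le hHlc hHl0 hHlR hA hφl ht hx.ne
        (hmax.congr (wfun_sub_glue_eventuallyEq_left hRl.le cl hHlR φl φr ht hx))
    · exact subsolution_scaledGA cr hRr.le hHrc hHr0 hHrR hA hφr ht hx.ne'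
        (hmax.congr (wfun_sub_glue_eventuallyEq_right hRr.le cr hHr0 φl φr ht hx))
    · rintro rfl
      rw [deriv_time_eq_of_isLocalExtr hRl.le cl hHlR hφl ht (Or.inr hmax)]
      linarith [min_le_left (Amax Hl Hr Rl Rr)
        (min (Hplus Hl (deriv (φl t) 0)) (Hminus Hr Rr (deriv (φr t) 0)))]
  · rintro φl φr ⟨hφl, hφr, hφ⟩ t x ht hminOn
    have hmin := hminOn.isLocalMin (domHJ_mem_nhds ht x)
    refine ⟨fun hx => ?_, fun hx => ?_, ?_⟩
    · exact supersolution_scaledGA cl hRl.le hφl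
        (hmin.congr (wfun_sub_glue_eventuallyEq_left hRl.le cl hHlR φl φr ht hx))
    · exact supersolution_scaledGA cr hRr.le hφr
        (hmin.congr (wfun_sub_glue_eventuallyEq_right hRr.le cr hHr0 φl φr ht hx))
    · rintro rfl
      rw [deriv_time_eq_of_isLocalExtr hRl.le cl hHlR hφl ht (Or.inl hmin)]
      have hl := le_Hplus cl hpl.1
        (le_deriv_of_isLocalMin_junction hRl.le cl hHlR hφl ht hpl hplA hmin)
      have hr := le_Hminus cr hpr.2
        (deriv_le_of_isLocalMin_junction hRl.le cl hHlR hRr.le cr hHr0 hφr ht (hφ t) hpr hprA hmin)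
      linarith [le_min le_rfl (le_min (hplA.trans hl) (hprA.trans hr))]
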